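/- arXiv:math/0512425 — 2 statements merged into one kernel-verified Lean document; each statement's English description precedes it below -/
import Mathlib

section
/- Let β ≥ 0 and let M : (0,1) → (0,∞) be a nondecreasing function with ∫₀^{1/2} (1/t)(log(1/t))^β dt/M(1−t) < ∞. Then (log(1/t))^{β+1} = o(M(1−t)) as t → 0+, i.e., lim_{t→0+} (log(1/t))^{β+1}/M(1−t) = 0. -/
open MeasureTheory Set Filter ENNReal

noncomputable section

/-- The logarithmic mass of `(t, √t)`. -/
theorem lintegral_const_mul_one_div_Ioo_sqrt {c t : ℝ} (hc : 0 ≤ c) (ht : 0 < t) (ht1 : t < 1) :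
    ∫⁻ s in Set.Ioo t (√t), ENNReal.ofReal (c * (1 / s)) =
      ENNReal.ofReal (c * (Real.log (1 / t) / 2)) := by
  have hsq : 0 < √t := Real.sqrt_pos.mpr ht
  have hle : t ≤ √t := Real.le_sqrt_of_sq_le (by nlinarith)
  have hii : IntervalIntegrable (fun s : ℝ => c * (1 / s)) volume t (√t) := by
    refine (intervalIntegral.intervalIntegrable_one_div (fun x hx => ?_) continuousOn_id).const_mul c
    rw [Set.uIcc_of_le hle] at hx
    exact (ht.trans_le hx.1).ne'
  rw [setLIntegral_congr Ioo_ae_eq_Ioc, ← ofReal_integral_eq_lintegral_ofReal hii.1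
    ((ae_restrict_iff' measurableSet_Ioc).mpr (Eventually.of_forall fun s hs => ?_)),
    ← intervalIntegral.integral_of_le hle, intervalIntegral.integral_const_mul,
    integral_one_div_of_pos ht hsq, Real.log_div hsq.ne' ht.ne', Real.log_sqrt ht.le,
    one_div, Real.log_inv]
  · congr 1
    ring
  · have : 0 < s := ht.trans hs.1
    show 0 ≤ c * (1 / s)
    positivity

/-- Bound on `(log (1/t)) ^ (β + 1) / M (1 - t)` by the integral over `(t, √t)`. -/
theorem ofReal_log_rpow_div_le_lintegral {β : ℝ} (hβ : 0 ≤ β) {M : ℝ → ℝ}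
    (hMpos : ∀ t ∈ Set.Ioo (0:ℝ) 1, 0 < M t) (hMmono : MonotoneOn M (Set.Ioo (0:ℝ) 1))
    {t : ℝ} (ht : 0 < t) (ht1 : t < 1) :
    ENNReal.ofReal ((1 / 2) ^ (β + 1) * ((Real.log (1 / t)) ^ (β + 1) / M (1 - t))) ≤
      ∫⁻ s in Set.Ioo t (√t),
        ENNReal.ofReal ((1 / s) * (Real.log (1 / s)) ^ β / M (1 - s)) := by
  have hL : 0 < Real.log (1 / t) := Real.log_pos (by rw [lt_div_iff₀ ht]; linarith)
  have hM : 0 < M (1 - t) := hMpos _ ⟨by linarith, by linarith⟩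
  have key := lintegral_const_mul_one_div_Ioo_sqrt
    (c := (Real.log (1 / t) / 2) ^ β / M (1 - t)) (by positivity) ht ht1
  have hconst : (1 / 2 : ℝ) ^ (β + 1) * ((Real.log (1 / t)) ^ (β + 1) / M (1 - t)) =
      (Real.log (1 / t) / 2) ^ β / M (1 - t) * (Real.log (1 / t) / 2) := by
    rw [← mul_div_assoc, ← Real.mul_rpow (by norm_num) hL.le, one_div_mul_eq_div,
      Real.rpow_add_one (by positivity)]
    ring
  rw [hconst, ← key]
  refine setLIntegral_mono' measurableSet_Ioo fun s hs => ENNReal.ofReal_le_ofReal ?_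
  have hs0 : 0 < s := ht.trans hs.1
  have hs1 : s < 1 := hs.2.trans_le (Real.sqrt_le_one.mpr ht1.le)
  have hMs : 0 < M (1 - s) := hMpos _ ⟨by linarith, by linarith⟩
  have hMle : M (1 - s) ≤ M (1 - t) :=
    hMmono ⟨by linarith, by linarith⟩ ⟨by linarith, by linarith⟩ (by linarith [hs.1])
  have hlog : Real.log (1 / t) / 2 ≤ Real.log (1 / s) := by
    have := Real.log_le_log hs0 hs.2.le
    rw [Real.log_sqrt ht.le] at this
    rw [one_div, one_div, Real.log_inv, Real.log_inv]
    linarith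
  have hrpow : 0 ≤ Real.log (1 / s) ^ β := Real.rpow_nonneg (by linarith) β
  rw [mul_comm, ← mul_div_assoc]
  gcongr

/-- If `M : (0,1) → (0,∞)` is nondecreasing and
`∫₀^{1/2} (1/t)(log(1/t))^β dt/M(1-t) < ∞`, then
`(log(1/t))^{β+1} = o(M(1-t))` as `t → 0⁺`. -/
theorem stmt13 (β : ℝ) (hβ : 0 ≤ β) (M : ℝ → ℝ)
    (hMpos : ∀ t ∈ Set.Ioo (0:ℝ) 1, 0 < M t)
    (hMmono : MonotoneOn M (Set.Ioo (0:ℝ) 1))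
    (hint : ∫⁻ t in Set.Ioo (0:ℝ) (1/2),
        ENNReal.ofReal ((1 / t) * (Real.log (1 / t)) ^ β / M (1 - t)) < ⊤) :
    Filter.Tendsto (fun t : ℝ => (Real.log (1 / t)) ^ (β + 1) / M (1 - t))
      (nhdsWithin 0 (Set.Ioi 0)) (nhds 0) := by
  have hI : Tendsto (fun t : ℝ => ∫⁻ s in Set.Ioo t (√t),
      ENNReal.ofReal ((1 / s) * (Real.log (1 / s)) ^ β / M (1 - s))
        ∂(volume.restrict (Set.Ioo (0:ℝ) (1/2)))) (nhdsWithin 0 (Set.Ioi 0)) (nhds 0) := by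
    refine tendsto_setLIntegral_zero hint.ne ?_
    have h0 : Tendsto (fun t : ℝ => ENNReal.ofReal (√t - t)) (nhdsWithin 0 (Set.Ioi 0))
        (nhds 0) := by
      have : Continuous fun t : ℝ => ENNReal.ofReal (√t - t) :=
        ENNReal.continuous_ofReal.comp (by fun_prop)
      simpa using (this.tendsto 0).mono_left nhdsWithin_le_nhds
    refine tendsto_of_tendsto_of_tendsto_of_le_of_le tendsto_const_nhds h0 (fun _ => zero_le)
      fun t => ?_
    exact (Measure.restrict_apply_le _ _).trans Real.volume_Ioo.le
  have hsmall : ∀ᶠ t : ℝ in nhdsWithin 0 (Set.Ioi 0), t ∈ Set.Ioo (0:ℝ) (1/4) :=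
    Ioo_mem_nhdsGT (by norm_num)
  have hscaled : Tendsto (fun t : ℝ =>
      ENNReal.ofReal ((1 / 2) ^ (β + 1) * ((Real.log (1 / t)) ^ (β + 1) / M (1 - t))))
      (nhdsWithin 0 (Set.Ioi 0)) (nhds 0) := by
    refine tendsto_of_tendsto_of_tendsto_of_le_of_le' tendsto_const_nhds hI
      (Eventually.of_forall fun _ => zero_le) ?_
    filter_upwards [hsmall] with t ht
    have hsub : Set.Ioo t (√t) ⊆ Set.Ioo (0:ℝ) (1/2) := by
      refine Set.Ioo_subset_Ioo ht.1.le ((Real.sqrt_le_left (by norm_num)).mpr ?_)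
      linarith [ht.2]
    rw [Measure.restrict_restrict_of_subset hsub]
    exact ofReal_log_rpow_div_le_lintegral hβ hMpos hMmono ht.1 (by linarith [ht.2])
  have hreal := ((ENNReal.tendsto_toReal ENNReal.zero_ne_top).comp hscaled).const_mul
    (((1 / 2 : ℝ) ^ (β + 1))⁻¹)
  rw [ENNReal.toReal_zero, mul_zero] at hreal
  refine hreal.congr' ?_
  filter_upwards [hsmall] with t ht
  have hL : 0 < Real.log (1 / t) := Real.log_pos (by rw [lt_div_iff₀ ht.1]; linarith [ht.2])
  have hM : 0 < M (1 - t) := hMpos _ ⟨by linarith [ht.2], by linarith [ht.1]⟩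
  rw [Function.comp_apply, ENNReal.toReal_ofReal (by positivity),
    inv_mul_cancel_left₀ (by positivity)]

end
end

section
/- Let β ≥ 0 and let M : (0,1) → (0,∞) be a nondecreasing function. Then ∫₀^{1/2} (1/t)(log(1/t))^β dt/M(1−t) = ∞ if and only if Σ_{k≥1} 2^{k(β+1)}/M(1−2^{−2^k}) = ∞. -/
open MeasureTheory Set Filter ENNReal

noncomputable section

/-- The integral of `1/t` over `[a, b)` is `log (b / a)`. -/
lemma setLIntegral_Ico_inv {a b : ℝ} (ha : 0 < a) (hab : a ≤ b) :
    ∫⁻ t in Set.Ico a b, ENNReal.ofReal t⁻¹ = ENNReal.ofReal (Real.log (b / a)) := by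
  rw [setLIntegral_congr Ico_ae_eq_Ioc, ← integral_inv_of_pos ha (ha.trans_le hab),
    intervalIntegral.integral_of_le hab, ofReal_integral_eq_lintegral_ofReal]
  · refine (intervalIntegrable_iff_integrableOn_Ioc_of_le hab).1 ?_
    refine intervalIntegral.intervalIntegrable_inv (fun x hx => ?_) continuousOn_id
    rw [uIcc_of_le hab] at hx
    exact (ha.trans_le hx.1).ne'
  · filter_upwards [ae_restrict_mem measurableSet_Ioc] with t ht
    exact inv_nonneg.2 (ha.trans ht.1).le

/-- A strictly antitone sequence tending to `0` cuts `(0, a 0)` into the intervals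
`[a (k + 1), a k)`, and a set integral over `(0, a 0)` is the sum of the pieces. -/
lemma lintegral_Ioo_eq_tsum_Ico {a : ℕ → ℝ} (ha : StrictAnti a) (hpos : ∀ k, 0 < a k)
    (hlim : Tendsto a atTop (nhds 0)) (f : ℝ → ℝ≥0∞) :
    ∫⁻ t in Set.Ioo 0 (a 0), f t = ∑' k, ∫⁻ t in Set.Ico (a (k + 1)) (a k), f t := by
  have hU : Set.Ioo 0 (a 0) = ⋃ k, Set.Ico (a (k + 1)) (a k) := by
    ext t
    simp only [mem_Ioo, mem_iUnion, mem_Ico]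
    constructor
    · rintro ⟨h0, h1⟩
      have hex : ∃ n, a n ≤ t := ((hlim.eventually_lt_const h0).exists).imp fun _ h => h.le
      classical
      obtain ⟨k, hk⟩ : ∃ k, Nat.find hex = k + 1 := by
        refine Nat.exists_eq_succ_of_ne_zero fun h => ?_
        have := Nat.find_spec hex
        rw [h] at this
        exact this.not_gt h1
      refine ⟨k, hk ▸ Nat.find_spec hex, not_le.1 (Nat.find_min hex (m := k) (by omega))⟩
    · rintro ⟨k, h0, h1⟩
      exact ⟨(hpos _).trans_le h0, h1.trans_le (ha.antitone (Nat.zero_le k))⟩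
  rw [hU, lintegral_iUnion (fun _ => measurableSet_Ico)]
  exact ha.antitone.pairwise_disjoint_on_Ico_succ

/-- If `J k` lies between positive finite multiples of `T (k + 1)` and `T k`, then `∑ J k` and
`∑ T (k + 1)` diverge simultaneously. -/
lemma tsum_eq_top_iff_of_le_shift {J T : ℕ → ℝ≥0∞} {c C : ℝ≥0∞} (hc : c ≠ 0) (hC : C ≠ ⊤)
    (hT : T 0 ≠ ⊤) (hlow : ∀ k, c * T (k + 1) ≤ J k) (hup : ∀ k, J k ≤ C * T k) :
    ∑' k, J k = ⊤ ↔ ∑' k, T (k + 1) = ⊤ := by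
  constructor
  · intro h
    by_contra hne
    have h1 : ∑' k, J k ≤ C * ∑' k, T k := by
      rw [← ENNReal.tsum_mul_left]
      exact ENNReal.tsum_le_tsum hup
    rw [h, top_le_iff, tsum_eq_zero_add' ENNReal.summable] at h1
    exact ENNReal.mul_ne_top hC (ENNReal.add_ne_top.2 ⟨hT, hne⟩) h1
  · intro h
    have h1 : c * ∑' k, T (k + 1) ≤ ∑' k, J k := by
      rw [← ENNReal.tsum_mul_left]
      exact ENNReal.tsum_le_tsum hlow
    rwa [h, ENNReal.mul_top hc, top_le_iff] at h1

lemma two_rpow_natCast_mul_add_one (k : ℕ) (β : ℝ) :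
    (2 : ℝ) ^ ((k : ℝ) * (β + 1)) = ((2 : ℝ) ^ k) ^ β * 2 ^ k := by
  rw [Real.rpow_mul zero_le_two, Real.rpow_natCast, Real.rpow_add_one (by positivity)]

/-- Discretization of the divergence condition along the doubling scale `q_k = 2^k`:
for nondecreasing `M : (0,1) → (0,∞)` and `β ≥ 0`,
`∫₀^{1/2} (1/t)(log(1/t))^β dt/M(1-t) = ∞` iff
`Σ_{k≥1} 2^{k(β+1)} / M(1 - 2^{-2^k}) = ∞`. -/
theorem stmt19 (β : ℝ) (hβ : 0 ≤ β) (M : ℝ → ℝ)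
    (hMpos : ∀ t ∈ Set.Ioo (0:ℝ) 1, 0 < M t)
    (hMmono : MonotoneOn M (Set.Ioo (0:ℝ) 1)) :
    (∫⁻ t in Set.Ioo (0:ℝ) (1/2),
        ENNReal.ofReal ((1 / t) * (Real.log (1 / t)) ^ β / M (1 - t)) = ⊤) ↔
      ∑' k : ℕ, ENNReal.ofReal
        ((2 : ℝ) ^ (((k : ℝ) + 1) * (β + 1)) / M (1 - (1/2 : ℝ) ^ (2 ^ (k + 1)))) = ⊤ := by
  set a : ℕ → ℝ := fun k => (1 / 2 : ℝ) ^ (2 ^ k) with ha_def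
  have hpos : ∀ k, 0 < a k := fun k => by positivity
  have hanti : StrictAnti a := fun m n hmn =>
    pow_lt_pow_right_of_lt_one₀ (by norm_num) (by norm_num)
      (Nat.pow_lt_pow_right one_lt_two hmn)
  have hlim : Tendsto a atTop (nhds 0) :=
    (_root_.tendsto_pow_atTop_nhds_zero_of_lt_one (by norm_num) (by norm_num)).comp
      (_root_.tendsto_pow_atTop_atTop_of_one_lt one_lt_two)
  have ha0 : a 0 = 1 / 2 := by simp [ha_def]
  have hlt : ∀ k, a k < 1 := fun k =>
    (hanti.antitone (Nat.zero_le k)).trans_lt (by rw [ha0]; norm_num)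
  have hmem : ∀ k, 1 - a k ∈ Set.Ioo (0 : ℝ) 1 := fun k =>
    ⟨by linarith [hlt k], by linarith [hpos k]⟩
  have hL : 0 < Real.log 2 := Real.log_pos one_lt_two
  have hlog : ∀ k, Real.log (a k) = -(2 ^ k * Real.log 2) := fun k => by
    simp [ha_def, Real.log_pow]
  have hint : ∀ (k : ℕ) (D : ℝ), 0 ≤ D →
      ∫⁻ t in Set.Ico (a (k + 1)) (a k), ENNReal.ofReal (D * t⁻¹) =
        ENNReal.ofReal (D * (2 ^ k * Real.log 2)) := fun k D hD => by
    simp_rw [ENNReal.ofReal_mul hD]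
    rw [lintegral_const_mul _ (by fun_prop),
      setLIntegral_Ico_inv (hpos _) (hanti (Nat.lt_succ_self k)).le,
      Real.log_div (hpos _).ne' (hpos _).ne', hlog, hlog]
    congr 2
    rw [Nat.succ_eq_add_one]
    ring
  have hbound : ∀ k, ∀ t ∈ Set.Ico (a (k + 1)) (a k), 0 < t ∧ 1 - t ∈ Set.Ioo (0 : ℝ) 1 ∧
      2 ^ k * Real.log 2 ≤ Real.log (1 / t) ∧
      Real.log (1 / t) ≤ 2 ^ (k + 1) * Real.log 2 := by
    rintro k t ⟨h1, h2⟩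
    have ht : 0 < t := (hpos _).trans_le h1
    have e1 := Real.log_le_log (hpos _) h1
    have e2 := Real.log_le_log ht h2.le
    rw [hlog] at e1 e2
    rw [one_div, Real.log_inv]
    exact ⟨ht, ⟨by linarith [hlt k], by linarith⟩, by linarith, by linarith⟩
  have hmain := tsum_eq_top_iff_of_le_shift
    (J := fun k => ∫⁻ t in Set.Ico (a (k + 1)) (a k),
      ENNReal.ofReal ((1 / t) * (Real.log (1 / t)) ^ β / M (1 - t)))
    (T := fun k => ENNReal.ofReal ((2 : ℝ) ^ ((k : ℝ) * (β + 1)) / M (1 - a k)))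
    (c := ENNReal.ofReal ((Real.log 2 / 2) ^ β * (Real.log 2 / 2)))
    (C := ENNReal.ofReal ((2 * Real.log 2) ^ β * Real.log 2))
    (ENNReal.ofReal_pos.2 (by positivity)).ne' ENNReal.ofReal_ne_top ENNReal.ofReal_ne_top
    (fun k => by
      have hM := hMpos _ (hmem (k + 1))
      have hscale : (2 ^ k * Real.log 2) ^ β = (2 ^ (k + 1)) ^ β * (Real.log 2 / 2) ^ β := by
        rw [← Real.mul_rpow (by positivity) (by positivity)]
        congr 1
        ring
      calc _ = ENNReal.ofReal ((2 ^ k * Real.log 2) ^ β / M (1 - a (k + 1)) *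
              (2 ^ k * Real.log 2)) := by
            rw [← ENNReal.ofReal_mul (by positivity), two_rpow_natCast_mul_add_one, hscale]
            congr 1
            ring
        _ = _ := (hint k _ (by positivity)).symm
        _ ≤ _ := setLIntegral_mono' measurableSet_Ico fun t ht => by
            obtain ⟨ht0, htm, hl, -⟩ := hbound k t ht
            have hMt := hMpos _ htm
            have hl0 : 0 ≤ Real.log (1 / t) := le_trans (by positivity) hl
            have hMle := hMmono htm (hmem (k + 1)) (by linarith [ht.1])
            rw [one_div_mul_eq_div, div_right_comm, ← div_eq_mul_inv]
            gcongr)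
    (fun k => by
      have hM := hMpos _ (hmem k)
      have hscale : (2 ^ (k + 1) * Real.log 2) ^ β = (2 ^ k) ^ β * (2 * Real.log 2) ^ β := by
        rw [← Real.mul_rpow (by positivity) (by positivity)]
        congr 1
        ring
      calc _ ≤ ∫⁻ t in Set.Ico (a (k + 1)) (a k),
              ENNReal.ofReal ((2 ^ (k + 1) * Real.log 2) ^ β / M (1 - a k) * t⁻¹) :=
            setLIntegral_mono' measurableSet_Ico fun t ht => by
              obtain ⟨ht0, htm, hl, hu⟩ := hbound k t ht
              have hMle := hMmono (hmem k) htm (by linarith [ht.2])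
              have hl0 : 0 ≤ Real.log (1 / t) := le_trans (by positivity) hl
              rw [one_div_mul_eq_div, div_right_comm, ← div_eq_mul_inv]
              gcongr
        _ = _ := hint k _ (by positivity)
        _ = _ := by
            rw [← ENNReal.ofReal_mul (by positivity), two_rpow_natCast_mul_add_one, hscale]
            congr 1
            ring)
  have hsplit := lintegral_Ioo_eq_tsum_Ico hanti hpos hlim fun t =>
    ENNReal.ofReal ((1 / t) * (Real.log (1 / t)) ^ β / M (1 - t))
  rw [ha0] at hsplit
  rw [hsplit, hmain]
  simp only [Nat.cast_add, Nat.cast_one, ha_def]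

end
end
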